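/- arXiv:1612.09215 — 13 statements merged into one kernel-verified Lean document; each statement's English description precedes it below -/
import Mathlib

section
/- Let σ = 0 or σ = 1/2. Then for every R ∈ (0, π/2) one has (2Σ sin²R − 6σ)/(2Σ sin²R − 3(1 − 2σ)) < 0, so there are no circular geodesics. Conversely, for every σ with 0 < σ < 1/2 there exists R ∈ (0, π/2) such that (2Σ sin²R − 6σ)/(2Σ sin²R − 3(1 − 2σ)) > 0. -/
/-- Squared tangential velocity of circular geodesics in the Linet–Tian spacetime
with `Λ > 0`, as a function of the rescaled radial coordinate `R = (√(3Λ)/2)ρ`,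
where `Σ = 1 - 2σ + 4σ²`. -/
noncomputable def Wsq (σ R : ℝ) : ℝ :=
  (2 * (1 - 2*σ + 4*σ^2) * Real.sin R ^ 2 - 6*σ) /
    (2 * (1 - 2*σ + 4*σ^2) * Real.sin R ^ 2 - 3 * (1 - 2*σ))

/-- For `σ = 0` or `σ = 1/2` there are no circular geodesics (`W² < 0` everywhere),
while for every `0 < σ < 1/2` there is some radius at which `W² > 0`, so circular
orbits exist. -/
theorem no_circular_orbits_iff :
    (∀ σ : ℝ, (σ = 0 ∨ σ = 1/2) →
      ∀ R ∈ Set.Ioo (0 : ℝ) (Real.pi / 2), Wsq σ R < 0) ∧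
    (∀ σ : ℝ, 0 < σ → σ < 1/2 →
      ∃ R ∈ Set.Ioo (0 : ℝ) (Real.pi / 2), 0 < Wsq σ R) := by
  refine ⟨?_, ?_⟩
  · rintro σ hσ R ⟨h0, h1⟩
    have hs : 0 < Real.sin R := Real.sin_pos_of_pos_of_lt_pi h0 (by linarith)
    have hs1 : Real.sin R ≤ 1 := Real.sin_le_one R
    have hp : 0 < Real.sin R ^ 2 := by positivity
    have hq : Real.sin R ^ 2 ≤ 1 := by nlinarith
    unfold Wsq
    rcases hσ with rfl | rfl
    · apply div_neg_of_pos_of_neg <;> nlinarith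
    · apply div_neg_of_neg_of_pos <;> nlinarith
  · intro σ h0 h1
    have hR : 0 < σ * (1 - 2 * σ) := mul_pos h0 (by linarith)
    have hR1 : σ * (1 - 2 * σ) < σ := by nlinarith
    have hR2 : σ * (1 - 2 * σ) < 1 - 2 * σ := by nlinarith
    have hpi := Real.pi_gt_three
    refine ⟨σ * (1 - 2 * σ), ⟨hR, by linarith⟩, ?_⟩
    have hs : 0 < Real.sin (σ * (1 - 2 * σ)) :=
      Real.sin_pos_of_pos_of_lt_pi hR (by linarith)
    have hs1 := Real.sin_lt hR
    have hq : Real.sin (σ * (1 - 2 * σ)) ^ 2 < σ * (1 - 2 * σ) := by nlinarith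
    have hS : (1 - 2*σ + 4*σ^2) ≤ 1 := by nlinarith
    have hm : (1 - 2*σ + 4*σ^2) * Real.sin (σ * (1 - 2 * σ)) ^ 2
        ≤ Real.sin (σ * (1 - 2 * σ)) ^ 2 :=
      mul_le_of_le_one_left (sq_nonneg _) hS
    unfold Wsq
    apply div_pos_of_neg_of_neg <;> linarith
end

section
/- Let 0 < σ < 1/4 and R ∈ (0, π/2). Then 0 < W²(R) < 1 (i.e. the circular geodesic at radius R is timelike) if and only if sin²R < 3σ/Σ. In particular there is an upper limit, depending on σ and Λ, on the radii at which timelike circular geodesics exist. -/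
/-- For `0 < σ < 1/4` and `R ∈ (0, π/2)`, the circular geodesic at radius `R` is
timelike, i.e. `0 < W²(R) < 1`, if and only if `sin²R < 3σ/Σ`. In particular
there is an upper limit, depending on `σ` and `Λ`, on the radii at which
timelike circular geodesics exist. -/
theorem Wsq_timelike_iff (σ R : ℝ) (hσ0 : 0 < σ) (hσ : σ < 1/4)
    (hR : R ∈ Set.Ioo (0 : ℝ) (Real.pi / 2)) :
    (0 < Wsq σ R ∧ Wsq σ R < 1) ↔
      Real.sin R ^ 2 < 3*σ / (1 - 2*σ + 4*σ^2) := by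
  have hS : 0 < 1 - 2*σ + 4*σ^2 := by nlinarith [sq_nonneg σ]
  rw [lt_div_iff₀ hS]
  unfold Wsq
  constructor
  · rintro ⟨h0, h1⟩
    rcases div_pos_iff.mp h0 with ⟨_, hD⟩ | ⟨hN, _⟩
    · rw [div_lt_one hD] at h1
      linarith
    · linarith
  · intro h
    have hN : 2 * (1 - 2*σ + 4*σ^2) * Real.sin R ^ 2 - 6*σ < 0 := by linarith
    have hD : 2 * (1 - 2*σ + 4*σ^2) * Real.sin R ^ 2 - 3 * (1 - 2*σ) < 0 := by linarith
    refine ⟨div_pos_of_neg_of_neg hN hD, ?_⟩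
    rw [div_lt_one_of_neg hD]
    linarith
end

section
/- Fix ρ > 0 and σ with 0 ≤ σ < 1/2, and set Σ = 1 − 2σ + 4σ². For Λ > 0 define W²(Λ) = (2Σ sin²((√(3Λ)/2)ρ) − 6σ)/(2Σ sin²((√(3Λ)/2)ρ) − 3(1 − 2σ)). Then lim_{Λ→0⁺} (W²(Λ) − 2σ/(1 − 2σ))/Λ = −(Σ/2)·(1 − 4σ)/(1 − 2σ)² · ρ². In particular W²(Λ) → W²_{LC} = 2σ/(1 − 2σ) as Λ → 0⁺, and at linear order a positive Λ decreases the tangential velocity when 0 ≤ σ < 1/4 and increases it when 1/4 < σ < 1/2. -/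
open Filter

/-- Squared tangential velocity of circular geodesics in the Linet–Tian spacetime,
at fixed coordinate radius `ρ` and mass parameter `σ`, as a function of the
cosmological constant `Λ > 0`; here `R = (√(3Λ)/2)ρ` and `Σ = 1 - 2σ + 4σ²`. -/
noncomputable def WsqLam (σ ρ Λ : ℝ) : ℝ :=
  (2 * (1 - 2*σ + 4*σ^2) * Real.sin (Real.sqrt (3*Λ) / 2 * ρ) ^ 2 - 6*σ) /
    (2 * (1 - 2*σ + 4*σ^2) * Real.sin (Real.sqrt (3*Λ) / 2 * ρ) ^ 2 - 3 * (1 - 2*σ))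

/-- At fixed `ρ > 0` and `0 ≤ σ < 1/2`, as `Λ → 0⁺` the squared tangential velocity
`W²(Λ)` tends to the Levi-Civita value `W²_LC = 2σ/(1-2σ)`, and at linear order
`(W²(Λ) - W²_LC)/Λ → -(Σ/2)·(1-4σ)/(1-2σ)²·ρ²`: a small positive `Λ` decreases
the tangential velocity when `0 ≤ σ < 1/4` and increases it when `1/4 < σ < 1/2`. -/
theorem Wsq_linear_order_in_Lambda (σ ρ : ℝ) (hρ : 0 < ρ) (hσ0 : 0 ≤ σ) (hσ : σ < 1/2) :
    Tendsto (fun Λ : ℝ => (WsqLam σ ρ Λ - 2*σ / (1 - 2*σ)) / Λ)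
      (nhdsWithin 0 (Set.Ioi 0))
      (nhds (-((1 - 2*σ + 4*σ^2) / 2) * ((1 - 4*σ) / (1 - 2*σ)^2) * ρ^2)) ∧
    Tendsto (fun Λ : ℝ => WsqLam σ ρ Λ)
      (nhdsWithin 0 (Set.Ioi 0)) (nhds (2*σ / (1 - 2*σ))) := by
  have h1 : (0:ℝ) < 1 - 2*σ := by linarith
  set S : ℝ := 1 - 2*σ + 4*σ^2 with hS
  have hx : Tendsto (fun Λ : ℝ => Real.sqrt (3*Λ) / 2 * ρ) (nhdsWithin 0 (Set.Ioi 0)) (nhds 0) := by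
    have hc : Continuous (fun Λ : ℝ => Real.sqrt (3*Λ) / 2 * ρ) := by fun_prop
    have := hc.tendsto 0
    simp only [mul_zero, Real.sqrt_zero, zero_div, zero_mul] at this
    exact this.mono_left nhdsWithin_le_nhds
  have hsinc : Tendsto (fun Λ : ℝ => Real.sinc (Real.sqrt (3*Λ) / 2 * ρ))
      (nhdsWithin 0 (Set.Ioi 0)) (nhds 1) := by
    have := (Real.continuous_sinc.tendsto 0).comp hx
    simpa [Real.sinc_zero, Function.comp_def] using this
  have hsin : Tendsto (fun Λ : ℝ => Real.sin (Real.sqrt (3*Λ) / 2 * ρ))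
      (nhdsWithin 0 (Set.Ioi 0)) (nhds 0) := by
    have := (Real.continuous_sin.tendsto 0).comp hx
    simpa [Function.comp_def] using this
  have hden : Tendsto (fun Λ : ℝ =>
      2 * S * Real.sin (Real.sqrt (3*Λ) / 2 * ρ) ^ 2 - 3 * (1 - 2*σ))
      (nhdsWithin 0 (Set.Ioi 0)) (nhds (2 * S * 0 ^ 2 - 3 * (1 - 2*σ))) :=
    ((hsin.pow 2).const_mul (2 * S)).sub_const _
  have hne : (2 * S * 0 ^ 2 - 3 * (1 - 2*σ)) ≠ 0 := by
    have : 2 * S * 0 ^ 2 - 3 * (1 - 2*σ) = -(3 * (1 - 2*σ)) := by ring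
    rw [this]
    exact neg_ne_zero.mpr (by positivity)
  constructor
  · have hmain := (((hsinc.pow 2).const_mul (2 * S * (3/4) * ρ^2 * (1 - 4*σ))).div hden hne).div_const
      (1 - 2*σ)
    have hlim : 2 * S * (3/4) * ρ^2 * (1 - 4*σ) * 1 ^ 2 / (2 * S * 0 ^ 2 - 3 * (1 - 2*σ)) / (1 - 2*σ)
        = -(S / 2) * ((1 - 4*σ) / (1 - 2*σ)^2) * ρ^2 := by
      have : 2 * S * 0 ^ 2 - 3 * (1 - 2*σ) = -(3 * (1 - 2*σ)) := by ring
      rw [this]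
      have h1' := h1.ne'
      generalize 1 - 2*σ = t at h1'
      field_simp
      ring
    rw [hlim] at hmain
    refine hmain.congr' ?_
    filter_upwards [hden.eventually_ne hne, self_mem_nhdsWithin] with Λ hd hΛ
    have hΛ' : (0:ℝ) < Λ := hΛ
    have hxp : Real.sqrt (3*Λ) / 2 * ρ ≠ 0 := by positivity
    have hsq : Real.sqrt (3*Λ) ^ 2 = 3 * Λ := Real.sq_sqrt (by positivity)
    have hs : Real.sin (Real.sqrt (3*Λ) / 2 * ρ) ^ 2
        = 3/4 * Λ * ρ^2 * Real.sinc (Real.sqrt (3*Λ) / 2 * ρ) ^ 2 := by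
      rw [Real.sinc_of_ne_zero hxp, div_pow, mul_pow (_ / 2) ρ, div_pow, hsq]
      field_simp
      norm_num
      ring
    have h1' := h1.ne'
    simp only [Pi.div_apply, WsqLam, ← hS]
    rw [hs] at hd ⊢
    generalize Real.sinc (Real.sqrt (3*Λ) / 2 * ρ) = q at hd ⊢
    rw [div_sub_div _ _ hd h1', div_div, div_div, div_eq_div_iff
      (mul_ne_zero hd h1') (mul_ne_zero (mul_ne_zero hd h1') hΛ'.ne')]
    ring
  · have hmain := (((hsin.pow 2).const_mul (2 * S)).sub_const (6*σ)).div hden hne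
    have hlim : (2 * S * 0 ^ 2 - 6*σ) / (2 * S * 0 ^ 2 - 3 * (1 - 2*σ)) = 2*σ / (1 - 2*σ) := by
      rw [div_eq_div_iff hne h1.ne']
      ring
    rw [hlim] at hmain
    exact hmain
end

section
/- For every σ with 0 < σ < 1/4 and every a₄ with 1/2 ≤ a₄ < 1, the quantity f(a₄, σ) = 2(a₄ − 1)(1 − σ)√(1 − 4σ) / (a₄√(1 − 4σ²) − (a₄ − 1)√(1 − 4σ)) satisfies −1 < f(a₄, σ) < 0. -/
/-- The function `f(a₄, σ)` controlling the distance between the two matching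
radii of the Linet–Tian spacetime with its interior and exterior sources. -/
noncomputable def fLT (a₄ σ : ℝ) : ℝ :=
  2 * (a₄ - 1) * (1 - σ) * Real.sqrt (1 - 4*σ) /
    (a₄ * Real.sqrt (1 - 4*σ^2) - (a₄ - 1) * Real.sqrt (1 - 4*σ))

/-- For every `0 < σ < 1/4` and every `1/2 ≤ a₄ < 1`, one has `-1 < f(a₄,σ) < 0`. -/
theorem fLT_bounds (σ a₄ : ℝ) (hσ0 : 0 < σ) (hσ : σ < 1/4)
    (ha : 1/2 ≤ a₄) (ha' : a₄ < 1) :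
    -1 < fLT a₄ σ ∧ fLT a₄ σ < 0 := by
  have hp : 0 < Real.sqrt (1 - 4*σ) := Real.sqrt_pos.mpr (by linarith)
  have hpq : Real.sqrt (1 - 4*σ) < Real.sqrt (1 - 4*σ^2) :=
    Real.sqrt_lt_sqrt (by linarith) (by nlinarith)
  unfold fLT
  generalize Real.sqrt (1 - 4*σ) = p at *
  generalize Real.sqrt (1 - 4*σ^2) = q at *
  have hb : 0 < 1 - a₄ := by linarith
  have hbp : 0 < (1 - a₄) * p := mul_pos hb hp
  have h1 : 0 < (1 - a₄) * p * σ := mul_pos hbp hσ0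
  have h2 : (1 - a₄) * p < (1 - a₄) * q := mul_lt_mul_of_pos_left hpq hb
  have h3 : (1 - a₄) * q ≤ a₄ * q :=
    mul_le_mul_of_nonneg_right (by linarith) (hp.trans hpq).le
  have hD : 0 < a₄ * q - (a₄ - 1) * p := by linarith
  constructor
  · rw [lt_div_iff₀ hD]
    linarith
  · apply div_neg_of_neg_of_pos _ hD
    have h4 : 0 < (1 - a₄) * p * (1 - σ) := mul_pos hbp (by linarith)
    linarith
end

section
/- Let Λ > 0, 0 < σ < 1/4 and 1/2 ≤ a₄ ≤ 1, and set Σ = 1 − 2σ + 4σ². Then (3σ/Σ)·(1 + f(a₄, σ)) lies strictly between 0 and 1 when a₄ < 1 and equals 3σ/Σ ∈ (0,1) when a₄ = 1, and there exists a unique ρ₂ ∈ (0, π/√(3Λ)) satisfying sin²((√(3Λ)/2) ρ₂) = (3σ/Σ)·(1 + f(a₄, σ)). -/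
/-- Matching of the Linet–Tian metric (`Λ > 0`, `0 < σ < 1/4`, `Σ = 1 - 2σ + 4σ²`)
with the conformally flat interior source with parameter `1/2 ≤ a₄ ≤ 1`:
the quantity `(3σ/Σ)(1 + f(a₄,σ))` lies strictly between `0` and `1` when
`a₄ < 1` and equals `3σ/Σ ∈ (0,1)` when `a₄ = 1`, and there is a unique radius
`ρ₂ ∈ (0, π/√(3Λ))` with `sin²((√(3Λ)/2) ρ₂) = (3σ/Σ)(1 + f(a₄,σ))`. -/
theorem exists_unique_matching_radius_interior (Λ σ a₄ : ℝ) (hΛ : 0 < Λ)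
    (hσ0 : 0 < σ) (hσ : σ < 1/4) (ha : 1/2 ≤ a₄) (ha' : a₄ ≤ 1) :
    ((a₄ < 1 →
        0 < 3*σ / (1 - 2*σ + 4*σ^2) * (1 + fLT a₄ σ) ∧
        3*σ / (1 - 2*σ + 4*σ^2) * (1 + fLT a₄ σ) < 1) ∧
     (a₄ = 1 →
        3*σ / (1 - 2*σ + 4*σ^2) * (1 + fLT a₄ σ) = 3*σ / (1 - 2*σ + 4*σ^2) ∧
        0 < 3*σ / (1 - 2*σ + 4*σ^2) ∧ 3*σ / (1 - 2*σ + 4*σ^2) < 1)) ∧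
    ∃! ρ₂ : ℝ, ρ₂ ∈ Set.Ioo 0 (Real.pi / Real.sqrt (3*Λ)) ∧
      Real.sin (Real.sqrt (3*Λ) / 2 * ρ₂) ^ 2 =
        3*σ / (1 - 2*σ + 4*σ^2) * (1 + fLT a₄ σ) := by
  have hS : 0 < 1 - 2*σ + 4*σ^2 := by nlinarith [sq_nonneg σ]
  have hq0 : 0 < 3*σ / (1 - 2*σ + 4*σ^2) := by positivity
  have hq1 : 3*σ / (1 - 2*σ + 4*σ^2) < 1 := by
    rw [div_lt_one hS]; nlinarith
  have hs : 0 < Real.sqrt (1 - 4*σ) := Real.sqrt_pos.mpr (by linarith)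
  have hst : Real.sqrt (1 - 4*σ) < Real.sqrt (1 - 4*σ^2) :=
    Real.sqrt_lt_sqrt (by linarith) (by nlinarith)
  have hf : 0 < 1 + fLT a₄ σ ∧ fLT a₄ σ ≤ 0 := by
    unfold fLT
    generalize Real.sqrt (1 - 4*σ) = s at *
    generalize Real.sqrt (1 - 4*σ^2) = t at *
    have h1 : 0 < a₄ * (t - s) := mul_pos (by linarith) (by linarith)
    have h2 : 0 ≤ (1 - a₄) * s := mul_nonneg (by linarith) hs.le
    have h3 : 0 ≤ (2 * a₄ - 1) * s := mul_nonneg (by linarith) hs.le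
    have h4 : 0 ≤ (1 - a₄) * s * σ := mul_nonneg h2 hσ0.le
    have h5 : 0 ≤ (1 - a₄) * s * (1 - σ) := mul_nonneg h2 (by linarith)
    have h6 : 0 < a₄ * s := mul_pos (by linarith) hs
    have hD : 0 < a₄ * t - (a₄ - 1) * s := by nlinarith
    refine ⟨?_, ?_⟩
    · rw [one_add_div hD.ne']
      apply div_pos _ hD
      nlinarith
    · apply div_nonpos_of_nonpos_of_nonneg _ hD.le
      nlinarith
  have hx0 : 0 < 3*σ / (1 - 2*σ + 4*σ^2) * (1 + fLT a₄ σ) := mul_pos hq0 hf.1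
  have hx1 : 3*σ / (1 - 2*σ + 4*σ^2) * (1 + fLT a₄ σ) < 1 := by
    nlinarith [mul_nonneg hq0.le (neg_nonneg.mpr hf.2)]
  refine ⟨⟨fun _ => ⟨hx0, hx1⟩, fun h => ⟨?_, hq0, hq1⟩⟩, ?_⟩
  · subst h; simp [fLT]
  generalize 3*σ / (1 - 2*σ + 4*σ^2) * (1 + fLT a₄ σ) = x at *
  have hL : 0 < Real.sqrt (3*Λ) := Real.sqrt_pos.mpr (by linarith)
  generalize Real.sqrt (3*Λ) = L at *
  have hy0 : 0 < Real.sqrt x := Real.sqrt_pos.mpr hx0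
  have hy1 : Real.sqrt x < 1 := by
    rw [Real.sqrt_lt' one_pos]; linarith
  refine ⟨2 / L * Real.arcsin (Real.sqrt x), ⟨⟨?_, ?_⟩, ?_⟩, ?_⟩
  · have := Real.arcsin_pos.mpr hy0
    positivity
  · have := Real.arcsin_lt_pi_div_two.mpr hy1
    rw [lt_div_iff₀ hL]
    have e : 2 / L * Real.arcsin (Real.sqrt x) * L = 2 * Real.arcsin (Real.sqrt x) := by
      field_simp
    linarith
  · have e : L / 2 * (2 / L * Real.arcsin (Real.sqrt x)) = Real.arcsin (Real.sqrt x) := by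
      field_simp
    rw [e, Real.sin_arcsin (by linarith) hy1.le, Real.sq_sqrt hx0.le]
  · rintro ρ ⟨⟨h0, h1⟩, h⟩
    rw [lt_div_iff₀ hL] at h1
    have hp : 0 < L / 2 * ρ := by positivity
    have hu : L / 2 * ρ < Real.pi / 2 := by nlinarith
    have hsin : 0 < Real.sin (L / 2 * ρ) :=
      Real.sin_pos_of_pos_of_lt_pi hp (by linarith [Real.pi_pos])
    rw [← h, Real.sqrt_sq hsin.le, Real.arcsin_sin (by linarith [Real.pi_pos]) hu.le]
    field_simp
end

section
/- Let Λ > 0, 0 < σ < 1/4 and 1/2 ≤ a₄ < 1. Let ρ₁ ∈ (0, π/√(3Λ)) be the unique solution of cos(√(3Λ) ρ₁) = (1 − 8σ + 4σ²)/Σ and let ρ₂ ∈ (0, π/√(3Λ)) be the unique solution of sin²((√(3Λ)/2) ρ₂) = (3σ/Σ)·(1 + f(a₄, σ)). Then ρ₂ < ρ₁; if instead a₄ = 1 then ρ₂ = ρ₁. -/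
/-- Consistency of the double matching giving a global non-singular static
Λ-vacuum spacetime: if `ρ₁ ∈ (0, π/√(3Λ))` solves the exterior matching
condition `cos(√(3Λ)ρ₁) = (1 - 8σ + 4σ²)/Σ` and `ρ₂ ∈ (0, π/√(3Λ))` solves the
interior matching condition `sin²((√(3Λ)/2)ρ₂) = (3σ/Σ)(1 + f(a₄,σ))`, with
`Λ > 0`, `0 < σ < 1/4` and `1/2 ≤ a₄ ≤ 1`, then `ρ₂ < ρ₁` when `a₄ < 1`, and
`ρ₂ = ρ₁` when `a₄ = 1`. -/
theorem matching_radii_ordered (Λ σ a₄ ρ₁ ρ₂ : ℝ) (hΛ : 0 < Λ)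
    (hσ0 : 0 < σ) (hσ : σ < 1/4) (ha : 1/2 ≤ a₄) (ha' : a₄ ≤ 1)
    (hρ₁mem : ρ₁ ∈ Set.Ioo 0 (Real.pi / Real.sqrt (3*Λ)))
    (hρ₁ : Real.cos (Real.sqrt (3*Λ) * ρ₁) =
      (1 - 8*σ + 4*σ^2) / (1 - 2*σ + 4*σ^2))
    (hρ₂mem : ρ₂ ∈ Set.Ioo 0 (Real.pi / Real.sqrt (3*Λ)))
    (hρ₂ : Real.sin (Real.sqrt (3*Λ) / 2 * ρ₂) ^ 2 =
      3*σ / (1 - 2*σ + 4*σ^2) * (1 + fLT a₄ σ)) :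
    (a₄ < 1 → ρ₂ < ρ₁) ∧ (a₄ = 1 → ρ₂ = ρ₁) := by
  have hk : 0 < Real.sqrt (3*Λ) := Real.sqrt_pos.mpr (by linarith)
  obtain ⟨h1, h1'⟩ := hρ₁mem
  obtain ⟨h2, h2'⟩ := hρ₂mem
  have hS : 0 < 1 - 2*σ + 4*σ^2 := by nlinarith [sq_nonneg (4*σ - 1)]
  rw [lt_div_iff₀ hk, mul_comm] at h1' h2'
  have p1 := mul_pos hk h1
  have p2 := mul_pos hk h2
  have hc2 : Real.cos (Real.sqrt (3*Λ) * ρ₂) =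
      1 - 2 * (3*σ / (1 - 2*σ + 4*σ^2) * (1 + fLT a₄ σ)) := by
    rw [← hρ₂, show Real.sqrt (3*Λ) * ρ₂ = 2 * (Real.sqrt (3*Λ) / 2 * ρ₂) by ring,
      Real.cos_two_mul, Real.cos_sq']
    ring
  have hc1 : Real.cos (Real.sqrt (3*Λ) * ρ₁) = 1 - 2 * (3*σ / (1 - 2*σ + 4*σ^2)) := by
    rw [hρ₁, div_eq_iff hS.ne', sub_mul, mul_assoc, div_mul_cancel₀ _ hS.ne']
    ring
  constructor
  · intro hlt
    have s1 : 0 < Real.sqrt (1 - 4*σ) := Real.sqrt_pos.mpr (by linarith)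
    have s2 : 0 < Real.sqrt (1 - 4*σ^2) := Real.sqrt_pos.mpr (by nlinarith)
    have hf : fLT a₄ σ < 0 := by
      unfold fLT
      apply div_neg_of_neg_of_pos
      · have : 0 < (1 - a₄) * (1 - σ) * Real.sqrt (1 - 4*σ) :=
          mul_pos (mul_pos (by linarith) (by linarith)) s1
        linarith
      · have e1 : 0 < a₄ * Real.sqrt (1 - 4*σ^2) := mul_pos (by linarith) s2
        have e2 : 0 < (1 - a₄) * Real.sqrt (1 - 4*σ) := mul_pos (by linarith) s1
        linarith
    have hq : 0 < 3*σ / (1 - 2*σ + 4*σ^2) := by positivity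
    have hcos : Real.cos (Real.sqrt (3*Λ) * ρ₁) < Real.cos (Real.sqrt (3*Λ) * ρ₂) := by
      rw [hc1, hc2]
      have := mul_neg_of_pos_of_neg hq hf
      linarith
    have := (Real.strictAntiOn_cos.lt_iff_gt ⟨p1.le, h1'.le⟩ ⟨p2.le, h2'.le⟩).mp hcos
    exact lt_of_mul_lt_mul_left this hk.le
  · intro he
    have hf : fLT a₄ σ = 0 := by
      unfold fLT
      rw [he]
      simp
    have := Real.injOn_cos ⟨p2.le, h2'.le⟩ ⟨p1.le, h1'.le⟩ (by rw [hc1, hc2, hf]; ring)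
    exact mul_left_cancel₀ hk.ne' this
end

section
/- Suppose 0 < σ ≤ 1/2 and that either L_z = 0, or σ > 1/4 (with L_z arbitrary and σ ≠ 1/4). Then V(ρ) → 0 as ρ → 0⁺. -/
open Filter

/-- The effective potential of radial geodesic motion in the Linet–Tian
spacetime with cosmological constant `Λ > 0`, mass parameter `σ`
(`Σ = 1 - 2σ + 4σ²`), topological constants `b ≠ 0`, `c ≠ 0`, momentum `Pz`
along the axis, angular momentum `Lz` about the axis, and causal character
`ε ∈ {0, 1}`.  Here `R = (√(3Λ)/2)ρ`, `P(ρ) = (2/√(3Λ)) tan R` and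
`Q(ρ) = (1/√(3Λ)) sin (2R)`, and
`V(ρ) = ε Q^{2/3} P^{-2(1-8σ+4σ²)/(3Σ)} + (Pz/b)² P^{8σ(1-σ)/Σ}
  + (Lz/c)² P^{-2(1-4σ)/Σ}` (real powers). -/
noncomputable def LTV (Λ σ b c Pz Lz ε : ℝ) (ρ : ℝ) : ℝ :=
  ε * ((1 / Real.sqrt (3*Λ)) * Real.sin (2 * (Real.sqrt (3*Λ) / 2 * ρ))) ^ ((2:ℝ)/3)
      * ((2 / Real.sqrt (3*Λ)) * Real.tan (Real.sqrt (3*Λ) / 2 * ρ)) ^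
          (-(2 * (1 - 8*σ + 4*σ^2)) / (3 * (1 - 2*σ + 4*σ^2))) +
    (Pz / b)^2 * ((2 / Real.sqrt (3*Λ)) * Real.tan (Real.sqrt (3*Λ) / 2 * ρ)) ^
          (8*σ*(1 - σ) / (1 - 2*σ + 4*σ^2)) +
    (Lz / c)^2 * ((2 / Real.sqrt (3*Λ)) * Real.tan (Real.sqrt (3*Λ) / 2 * ρ)) ^
          (-(2 * (1 - 4*σ)) / (1 - 2*σ + 4*σ^2))

/-- If `0 < σ ≤ 1/2` and either `Lz = 0` or `σ > 1/4`, the effective potential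
`V(ρ)` tends to `0` as `ρ → 0⁺`. -/
theorem LTV_tendsto_zero_axis (Λ σ b c Pz Lz ε : ℝ) (hΛ : 0 < Λ)
    (hb : b ≠ 0) (hc : c ≠ 0) (hε : ε = 0 ∨ ε = 1)
    (hσ0 : 0 < σ) (hσ : σ ≤ 1/2) (h : Lz = 0 ∨ 1/4 < σ) :
    Tendsto (LTV Λ σ b c Pz Lz ε) (nhdsWithin 0 (Set.Ioi 0)) (nhds 0) := by
  have hS : 0 < 1 - 2*σ + 4*σ^2 := by nlinarith [sq_nonneg (4*σ - 1)]
  have hs : 0 < Real.sqrt (3*Λ) := Real.sqrt_pos.mpr (by linarith)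
  set s := Real.sqrt (3*Λ) with hsdef
  have hcosne : Real.cos (s / 2 * 0) ≠ 0 := by simp
  have hlin : ContinuousAt (fun ρ : ℝ => s / 2 * ρ) 0 := by fun_prop
  have hP : Tendsto (fun ρ : ℝ => (2 / s) * Real.tan (s / 2 * ρ))
      (nhdsWithin 0 (Set.Ioi 0)) (nhds 0) := by
    have h1 : ContinuousAt (fun ρ : ℝ => Real.tan (s / 2 * ρ)) 0 :=
      ContinuousAt.comp (g := Real.tan) (f := fun ρ : ℝ => s / 2 * ρ)
        (Real.continuousAt_tan.mpr hcosne) hlin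
    have h2 := (h1.tendsto.const_mul (2 / s))
    simp only [mul_zero, Real.tan_zero] at h2
    exact h2.mono_left nhdsWithin_le_nhds
  have hC : Tendsto (fun ρ : ℝ => (Real.cos (s / 2 * ρ) ^ 2) ^ ((2:ℝ)/3))
      (nhdsWithin 0 (Set.Ioi 0)) (nhds 1) := by
    have h1 : Tendsto (fun ρ : ℝ => Real.cos (s / 2 * ρ) ^ 2) (nhds 0) (nhds 1) := by
      have : Continuous (fun ρ : ℝ => Real.cos (s / 2 * ρ) ^ 2) := by fun_prop
      simpa using this.tendsto 0
    have h2 := h1.rpow_const (p := (2:ℝ)/3) (Or.inl one_ne_zero)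
    rw [Real.one_rpow] at h2
    exact h2.mono_left nhdsWithin_le_nhds
  have hpow : ∀ e : ℝ, 0 < e → Tendsto (fun ρ : ℝ => ((2 / s) * Real.tan (s / 2 * ρ)) ^ e)
      (nhdsWithin 0 (Set.Ioi 0)) (nhds 0) := by
    intro e he
    have := hP.rpow_const (p := e) (Or.inr he.le)
    rwa [Real.zero_rpow he.ne'] at this
  have hT1 : Tendsto (fun ρ : ℝ => ε * ((1 / s) * Real.sin (2 * (s / 2 * ρ))) ^ ((2:ℝ)/3)
      * ((2 / s) * Real.tan (s / 2 * ρ)) ^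
          (-(2 * (1 - 8*σ + 4*σ^2)) / (3 * (1 - 2*σ + 4*σ^2))))
      (nhdsWithin 0 (Set.Ioi 0)) (nhds 0) := by
    have h1 := ((hpow (4*σ/(1 - 2*σ + 4*σ^2)) (by positivity)).mul hC).const_mul ε
    rw [zero_mul, mul_zero] at h1
    refine h1.congr' ?_
    have hmem : Set.Ioo (0:ℝ) (Real.pi / s) ∈ nhdsWithin (0:ℝ) (Set.Ioi 0) :=
      Ioo_mem_nhdsGT (div_pos Real.pi_pos hs)
    filter_upwards [hmem] with ρ hρ
    have hR0 : 0 < s / 2 * ρ := mul_pos (by positivity) hρ.1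
    have hR1 : s / 2 * ρ < Real.pi / 2 := by
      have := (lt_div_iff₀ hs).mp hρ.2
      linarith
    have hcos : 0 < Real.cos (s / 2 * ρ) :=
      Real.cos_pos_of_mem_Ioo ⟨by linarith [Real.pi_pos], hR1⟩
    have htan : 0 < Real.tan (s / 2 * ρ) := Real.tan_pos_of_pos_of_lt_pi_div_two hR0 hR1
    have hPp : 0 < (2 / s) * Real.tan (s / 2 * ρ) := by positivity
    have hQ : (1 / s) * Real.sin (2 * (s / 2 * ρ))
        = ((2 / s) * Real.tan (s / 2 * ρ)) * Real.cos (s / 2 * ρ) ^ 2 := by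
      rw [Real.sin_two_mul, ← Real.tan_mul_cos hcos.ne']
      ring
    have hexp : 4*σ/(1 - 2*σ + 4*σ^2)
        = (2:ℝ)/3 + -(2 * (1 - 8*σ + 4*σ^2)) / (3 * (1 - 2*σ + 4*σ^2)) := by
      have := hS.ne'
      generalize hD : 1 - 2*σ + 4*σ^2 = D at *
      field_simp
      rw [← hD]
      ring
    rw [hQ, Real.mul_rpow hPp.le (by positivity), hexp, Real.rpow_add hPp]
    ring
  have hT2 := (hpow (8*σ*(1 - σ) / (1 - 2*σ + 4*σ^2))
    (div_pos (mul_pos (by positivity) (by linarith)) hS)).const_mul ((Pz / b)^2)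
  have hT3 : Tendsto (fun ρ : ℝ => (Lz / c)^2 * ((2 / s) * Real.tan (s / 2 * ρ)) ^
          (-(2 * (1 - 4*σ)) / (1 - 2*σ + 4*σ^2)))
      (nhdsWithin 0 (Set.Ioi 0)) (nhds 0) := by
    rcases h with h | h
    · simp [h]
    · have := (hpow (-(2 * (1 - 4*σ)) / (1 - 2*σ + 4*σ^2))
        (div_pos (by linarith) hS)).const_mul ((Lz / c)^2)
      rwa [mul_zero] at this
  have hall := (hT1.add hT2).add hT3
  simp only [mul_zero, add_zero] at hall
  exact hall
end

section
/- Suppose σ = 1/4. Then V(ρ) → (L_z/c)² as ρ → 0⁺. -/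
open Filter

/-- If `σ = 1/4`, the effective potential `V(ρ)` tends to `(Lz/c)²` as `ρ → 0⁺`. -/
theorem LTV_tendsto_axis_sigma_quarter (Λ σ b c Pz Lz ε : ℝ) (hΛ : 0 < Λ)
    (hb : b ≠ 0) (hc : c ≠ 0) (hε : ε = 0 ∨ ε = 1) (hσ : σ = 1/4) :
    Tendsto (LTV Λ σ b c Pz Lz ε) (nhdsWithin 0 (Set.Ioi 0))
      (nhds ((Lz / c)^2)) := by
  subst hσ
  have e1 : (-(2 * (1 - 8*(1/4) + 4*(1/4)^2)) / (3 * (1 - 2*(1/4) + 4*(1/4)^2)) : ℝ) = 2/3 := by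
    norm_num
  have e2 : (8*(1/4)*(1 - 1/4) / (1 - 2*(1/4) + 4*(1/4)^2) : ℝ) = 2 := by norm_num
  have e3 : (-(2 * (1 - 4*(1/4))) / (1 - 2*(1/4) + 4*(1/4)^2) : ℝ) = 0 := by norm_num
  have ht : ContinuousAt
      (fun ρ : ℝ => (2 / Real.sqrt (3*Λ)) * Real.tan (Real.sqrt (3*Λ) / 2 * ρ)) 0 := by
    refine continuousAt_const.mul (ContinuousAt.comp (g := Real.tan) ?_ (by fun_prop))
    rw [Real.continuousAt_tan]
    simp
  have hs : ContinuousAt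
      (fun ρ : ℝ => (1 / Real.sqrt (3*Λ)) * Real.sin (2 * (Real.sqrt (3*Λ) / 2 * ρ))) 0 := by
    fun_prop
  have key : ContinuousAt (LTV Λ (1/4) b c Pz Lz ε) 0 := by
    unfold LTV
    simp only [e1, e2, e3, Real.rpow_zero]
    refine ((((continuousAt_const.mul (hs.rpow_const (Or.inr (by norm_num)))).mul
      (ht.rpow_const (Or.inr (by norm_num)))).add
      (continuousAt_const.mul (ht.rpow_const (Or.inr (by norm_num))))).add continuousAt_const)
  have h0 : LTV Λ (1/4) b c Pz Lz ε 0 = (Lz / c)^2 := by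
    unfold LTV
    simp only [e1, e2, e3, Real.rpow_zero]
    norm_num
  have h := key.tendsto
  rw [h0] at h
  exact h.mono_left nhdsWithin_le_nhds
end

section
/- Suppose either (i) 1/4 < σ ≤ 1/2 and at least one of ε = 1, P_z ≠ 0, L_z ≠ 0 holds, or (ii) 0 < σ ≤ 1/4 and P_z ≠ 0. Then V(ρ) → +∞ as ρ → (π/√(3Λ))⁻. -/
open Filter

/-- The areal function `P` blows up at the second singularity. -/
theorem LTP_tendsto (s : ℝ) (hs : 0 < s) :
    Tendsto (fun ρ : ℝ => (2 / s) * Real.tan (s / 2 * ρ))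
      (nhdsWithin (Real.pi / s) (Set.Iio (Real.pi / s))) atTop := by
  refine Tendsto.const_mul_atTop (by positivity) ?_
  refine Real.tendsto_tan_pi_div_two.comp ?_
  refine tendsto_nhdsWithin_of_tendsto_nhds_of_eventually_within _ ?_ ?_
  · have h1 : Tendsto (fun ρ : ℝ => s / 2 * ρ) (nhds (Real.pi / s))
        (nhds (s / 2 * (Real.pi / s))) := (continuous_const.mul continuous_id).tendsto _
    have h2 : s / 2 * (Real.pi / s) = Real.pi / 2 := by field_simp
    rw [h2] at h1
    exact h1.mono_left nhdsWithin_le_nhds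
  · filter_upwards [self_mem_nhdsWithin] with ρ hρ
    have hρ' : ρ < Real.pi / s := hρ
    rw [lt_div_iff₀ hs] at hρ'
    show s / 2 * ρ < Real.pi / 2
    linarith

/-- Lower bound for the first term of the potential. -/
theorem LTQ_bound (s x a : ℝ) (hs : 0 < s) (hP : 1 ≤ (2 / s) * Real.tan x) :
    (1 + s ^ 2 / 4) ^ (-((2:ℝ)/3)) * ((2 / s) * Real.tan x) ^ (a - 2/3) ≤
      ((1 / s) * Real.sin (2 * x)) ^ ((2:ℝ)/3) * ((2 / s) * Real.tan x) ^ a := by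
  have hcos : Real.cos x ≠ 0 := by
    intro h
    rw [Real.tan_eq_sin_div_cos, h] at hP
    norm_num at hP
  have hQ : (1 / s) * Real.sin (2 * x) = ((2 / s) * Real.tan x) * Real.cos x ^ 2 := by
    rw [Real.sin_two_mul, Real.tan_eq_sin_div_cos]
    field_simp
  have ht : Real.tan x = s / 2 * ((2 / s) * Real.tan x) := by field_simp
  have hc : Real.cos x ^ 2 = (1 + (s / 2 * ((2 / s) * Real.tan x)) ^ 2)⁻¹ := by
    rw [← ht, Real.inv_one_add_tan_sq hcos]
  rw [hQ, hc]
  generalize (2 / s) * Real.tan x = p at hP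
  have hp : 0 < p := by linarith
  have hK : 0 < 1 + s ^ 2 / 4 := by positivity
  have e1 : (1 + s ^ 2 / 4) ^ (-((2:ℝ)/3)) * p ^ (a - 2/3)
      = ((1 + s ^ 2 / 4)⁻¹ * p⁻¹) ^ ((2:ℝ)/3) * p ^ a := by
    rw [Real.mul_rpow (by positivity) (by positivity), Real.inv_rpow hK.le,
      Real.inv_rpow hp.le, Real.rpow_neg hK.le, Real.rpow_sub hp]
    ring
  rw [e1]
  refine mul_le_mul_of_nonneg_right ?_ (by positivity)
  refine Real.rpow_le_rpow (by positivity) ?_ (by norm_num)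
  rw [← mul_inv, ← div_eq_mul_inv, inv_eq_one_div, div_le_div_iff₀ (by positivity) (by positivity)]
  nlinarith [mul_pos hp hp]

/-- If either `1/4 < σ ≤ 1/2` and at least one of `ε = 1`, `Pz ≠ 0`, `Lz ≠ 0`
holds, or `0 < σ ≤ 1/4` and `Pz ≠ 0`, then the effective potential `V(ρ)` tends
to `+∞` as `ρ` approaches the second singularity `π/√(3Λ)` from below. -/
theorem LTV_tendsto_atTop_second_singularity (Λ σ b c Pz Lz ε : ℝ) (hΛ : 0 < Λ)
    (hb : b ≠ 0) (hc : c ≠ 0) (hε : ε = 0 ∨ ε = 1)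
    (h : (1/4 < σ ∧ σ ≤ 1/2 ∧ (ε = 1 ∨ Pz ≠ 0 ∨ Lz ≠ 0)) ∨
         (0 < σ ∧ σ ≤ 1/4 ∧ Pz ≠ 0)) :
    Tendsto (LTV Λ σ b c Pz Lz ε)
      (nhdsWithin (Real.pi / Real.sqrt (3*Λ)) (Set.Iio (Real.pi / Real.sqrt (3*Λ))))
      atTop := by
  have hs : 0 < Real.sqrt (3*Λ) := Real.sqrt_pos.mpr (by positivity)
  have hσ0 : 0 < σ := by rcases h with h | h <;> linarith [h.1]
  have hσ1 : σ ≤ 1/2 := by rcases h with h | h <;> linarith [h.2.1]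
  have hS : 0 < 1 - 2*σ + 4*σ^2 := by nlinarith [sq_nonneg (σ - 1/4)]
  have hε0 : 0 ≤ ε := by rcases hε with h | h <;> simp [h]
  unfold LTV
  generalize Real.sqrt (3*Λ) = s at hs
  have hP := LTP_tendsto s hs
  have hP1 := hP.eventually_ge_atTop 1
  have hpow : ∀ e : ℝ, 0 < e → Tendsto (fun ρ : ℝ => ((2 / s) * Real.tan (s / 2 * ρ)) ^ e)
      (nhdsWithin (Real.pi / s) (Set.Iio (Real.pi / s))) atTop :=
    fun e he => (tendsto_rpow_atTop he).comp hP
  have hterm1 : ∀ a : ℝ, ∀ ρ : ℝ, 1 ≤ (2 / s) * Real.tan (s / 2 * ρ) →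
      0 ≤ ε * ((1 / s) * Real.sin (2 * (s / 2 * ρ))) ^ ((2:ℝ)/3)
        * ((2 / s) * Real.tan (s / 2 * ρ)) ^ a := by
    intro a ρ hρ
    rw [mul_assoc]
    refine mul_nonneg hε0 (le_trans ?_ (LTQ_bound s _ a hs hρ))
    have : 0 < (2 / s) * Real.tan (s / 2 * ρ) := by linarith
    positivity
  have hterm : ∀ k e : ℝ, ∀ ρ : ℝ, 1 ≤ (2 / s) * Real.tan (s / 2 * ρ) →
      0 ≤ k ^ 2 * ((2 / s) * Real.tan (s / 2 * ρ)) ^ e := by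
    intro k e ρ hρ
    have : 0 < (2 / s) * Real.tan (s / 2 * ρ) := by linarith
    positivity
  have caseP : Pz ≠ 0 → Tendsto (fun ρ : ℝ => (Pz / b)^2 * ((2 / s) * Real.tan (s / 2 * ρ)) ^
          (8*σ*(1 - σ) / (1 - 2*σ + 4*σ^2)))
      (nhdsWithin (Real.pi / s) (Set.Iio (Real.pi / s))) atTop := by
    intro hPz
    refine (hpow _ ?_).const_mul_atTop (by positivity)
    have : 0 < 1 - σ := by linarith
    positivity
  have finP : Pz ≠ 0 → _ := fun hPz => tendsto_atTop_mono' _ (by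
    filter_upwards [hP1] with ρ hρ
    have h1 := hterm1 (-(2 * (1 - 8*σ + 4*σ^2)) / (3 * (1 - 2*σ + 4*σ^2))) ρ hρ
    have h3 := hterm (Lz / c) (-(2 * (1 - 4*σ)) / (1 - 2*σ + 4*σ^2)) ρ hρ
    exact (le_add_of_nonneg_left h1).trans (le_add_of_nonneg_right h3)) (caseP hPz)
  rcases h with ⟨h4, -, h | h | h⟩ | ⟨-, -, h⟩
  · have hexp : 0 < -(2 * (1 - 8*σ + 4*σ^2)) / (3 * (1 - 2*σ + 4*σ^2)) - 2/3 := by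
      have e : -(2 * (1 - 8*σ + 4*σ^2)) / (3 * (1 - 2*σ + 4*σ^2)) - 2/3
          = 4 * ((1 - σ) * (4*σ - 1)) / (3 * (1 - 2*σ + 4*σ^2)) := by
        rw [div_sub_div _ _ (by positivity) (by norm_num), div_eq_div_iff (by positivity) (by positivity)]
        ring
      rw [e]
      have h5 : 0 < 1 - σ := by linarith
      have h6 : 0 < 4*σ - 1 := by linarith
      positivity
    have hK : 0 < (1 + s ^ 2 / 4) ^ (-((2:ℝ)/3)) := by positivity
    refine tendsto_atTop_mono' _ ?_ ((hpow _ hexp).const_mul_atTop hK)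
    filter_upwards [hP1] with ρ hρ
    have h1 := LTQ_bound s _ (-(2 * (1 - 8*σ + 4*σ^2)) / (3 * (1 - 2*σ + 4*σ^2))) hs hρ
    have h2 := hterm (Pz / b) (8*σ*(1 - σ) / (1 - 2*σ + 4*σ^2)) ρ hρ
    have h3 := hterm (Lz / c) (-(2 * (1 - 4*σ)) / (1 - 2*σ + 4*σ^2)) ρ hρ
    rw [h, one_mul]
    linarith
  · exact finP h
  · have hexp : 0 < -(2 * (1 - 4*σ)) / (1 - 2*σ + 4*σ^2) := div_pos (by linarith) hS
    refine tendsto_atTop_mono' _ ?_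
      ((hpow _ hexp).const_mul_atTop (show 0 < (Lz / c)^2 by positivity))
    filter_upwards [hP1] with ρ hρ
    have h1 := hterm1 (-(2 * (1 - 8*σ + 4*σ^2)) / (3 * (1 - 2*σ + 4*σ^2))) ρ hρ
    have h2 := hterm (Pz / b) (8*σ*(1 - σ) / (1 - 2*σ + 4*σ^2)) ρ hρ
    linarith
  · exact finP h
end

section
/- Suppose 0 ≤ σ < 1/4 and P_z = 0. Then V(ρ) → 0 as ρ → (π/√(3Λ))⁻, for any ε ∈ {0,1} and any L_z. -/
open Filter

/-- If `0 ≤ σ < 1/4` and `Pz = 0`, the effective potential `V(ρ)` tends to `0`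
as `ρ` approaches the second singularity `π/√(3Λ)` from below, for any
`ε ∈ {0,1}` and any `Lz`. -/
theorem LTV_tendsto_zero_second_singularity (Λ σ b c Pz Lz ε : ℝ) (hΛ : 0 < Λ)
    (hb : b ≠ 0) (hc : c ≠ 0) (hε : ε = 0 ∨ ε = 1)
    (hσ0 : 0 ≤ σ) (hσ : σ < 1/4) (hPz : Pz = 0) :
    Tendsto (LTV Λ σ b c Pz Lz ε)
      (nhdsWithin (Real.pi / Real.sqrt (3*Λ)) (Set.Iio (Real.pi / Real.sqrt (3*Λ))))
      (nhds 0) := by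
  have hs : 0 < Real.sqrt (3*Λ) := Real.sqrt_pos.mpr (by linarith)
  set s := Real.sqrt (3*Λ) with hsdef
  have hSig : 0 < 1 - 2*σ + 4*σ^2 := by nlinarith [sq_nonneg (σ - 1/4)]
  have hR : Tendsto (fun ρ : ℝ => s / 2 * ρ) (nhdsWithin (Real.pi / s) (Set.Iio (Real.pi / s)))
      (nhdsWithin (Real.pi / 2) (Set.Iio (Real.pi / 2))) := by
    apply tendsto_nhdsWithin_of_tendsto_nhds_of_eventually_within
    · have h1 : Tendsto (fun ρ : ℝ => s / 2 * ρ) (nhds (Real.pi / s))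
          (nhds (s / 2 * (Real.pi / s))) := by
        apply Continuous.tendsto
        fun_prop
      have h2 : s / 2 * (Real.pi / s) = Real.pi / 2 := by field_simp
      rw [h2] at h1
      exact h1.mono_left nhdsWithin_le_nhds
    · filter_upwards [self_mem_nhdsWithin] with ρ hρ
      have h3 : ρ < Real.pi / s := hρ
      have h4 : ρ * s < Real.pi := (lt_div_iff₀ hs).mp h3
      show s / 2 * ρ < Real.pi / 2
      linarith
  have key : Tendsto (fun R : ℝ => ε * ((1 / s) * Real.sin (2 * R)) ^ ((2:ℝ)/3)
      * ((2 / s) * Real.tan R) ^ (-(2 * (1 - 8*σ + 4*σ^2)) / (3 * (1 - 2*σ + 4*σ^2))) +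
    (Pz / b)^2 * ((2 / s) * Real.tan R) ^ (8*σ*(1 - σ) / (1 - 2*σ + 4*σ^2)) +
    (Lz / c)^2 * ((2 / s) * Real.tan R) ^ (-(2 * (1 - 4*σ)) / (1 - 2*σ + 4*σ^2)))
      (nhdsWithin (Real.pi / 2) (Set.Iio (Real.pi / 2))) (nhds 0) := by
    have hP : Tendsto (fun R : ℝ => (2 / s) * Real.tan R)
        (nhdsWithin (Real.pi / 2) (Set.Iio (Real.pi / 2))) atTop :=
      Real.tendsto_tan_pi_div_two.const_mul_atTop (by positivity)
    have hpow : ∀ k : ℝ, 0 < k → Tendsto (fun R : ℝ => ((2 / s) * Real.tan R) ^ (-k))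
        (nhdsWithin (Real.pi / 2) (Set.Iio (Real.pi / 2))) (nhds 0) :=
      fun k hk => (tendsto_rpow_neg_atTop hk).comp hP
    have hk1 : 0 < 4 * ((1 - σ) * (1 - 4*σ)) / (3 * (1 - 2*σ + 4*σ^2)) := by
      have h1 : 0 < 1 - σ := by linarith
      have h2 : 0 < 1 - 4*σ := by linarith
      positivity
    have hk2 : 0 < 2 * (1 - 4*σ) / (1 - 2*σ + 4*σ^2) := by
      have h2 : 0 < 1 - 4*σ := by linarith
      positivity
    have hQP : Tendsto (fun R : ℝ => (4 / s^2 * Real.sin R ^ 2) ^ ((2:ℝ)/3))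
        (nhdsWithin (Real.pi / 2) (Set.Iio (Real.pi / 2)))
        (nhds ((4 / s^2 * Real.sin (Real.pi/2) ^ 2) ^ ((2:ℝ)/3))) := by
      have hc : Continuous (fun R : ℝ => (4 / s^2 * Real.sin R ^ 2) ^ ((2:ℝ)/3)) := by
        apply Continuous.rpow_const
        · fun_prop
        · intro x
          right
          norm_num
      exact (hc.tendsto _).mono_left nhdsWithin_le_nhds
    have hmain := ((hQP.mul (hpow _ hk1)).const_mul ε).add ((hpow _ hk2).const_mul ((Lz / c)^2))
    simp only [mul_zero, add_zero] at hmain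
    refine hmain.congr' ?_
    have hpos : ∀ᶠ R in nhdsWithin (Real.pi / 2) (Set.Iio (Real.pi / 2)), 0 < R :=
      nhdsWithin_le_nhds (lt_mem_nhds (by positivity))
    filter_upwards [self_mem_nhdsWithin, hpos] with R hR2 hR0
    have hR3 : R < Real.pi / 2 := hR2
    have hcos : 0 < Real.cos R := Real.cos_pos_of_mem_Ioo ⟨by linarith, hR3⟩
    have hsin : 0 < Real.sin R := Real.sin_pos_of_pos_of_lt_pi hR0 (by linarith)
    have htan : 0 < (2 / s) * Real.tan R := by
      rw [Real.tan_eq_sin_div_cos]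
      positivity
    have e1 : (1 / s) * Real.sin (2 * R)
        = (4 / s^2 * Real.sin R ^ 2) * ((2 / s) * Real.tan R)⁻¹ := by
      rw [Real.sin_two_mul, Real.tan_eq_sin_div_cos]
      field_simp
      try ring
    have e2 : -(4 * ((1 - σ) * (1 - 4*σ)) / (3 * (1 - 2*σ + 4*σ^2)))
        = -((2:ℝ)/3) + -(2 * (1 - 8*σ + 4*σ^2)) / (3 * (1 - 2*σ + 4*σ^2)) := by
      have hne : 1 - 2*σ + 4*σ^2 ≠ 0 := hSig.ne'
      generalize hS : 1 - 2*σ + 4*σ^2 = S at hne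
      field_simp
      rw [← hS]
      ring
    have hX : 0 ≤ 4 / s^2 * Real.sin R ^ 2 := by positivity
    have e3 : ((4 / s^2 * Real.sin R ^ 2) * ((2 / s) * Real.tan R)⁻¹) ^ ((2:ℝ)/3)
        = (4 / s^2 * Real.sin R ^ 2) ^ ((2:ℝ)/3) * ((2 / s) * Real.tan R) ^ (-((2:ℝ)/3)) := by
      rw [Real.mul_rpow hX (inv_nonneg.mpr htan.le), Real.inv_rpow htan.le,
        ← Real.rpow_neg htan.le]
    rw [e1, e3, e2, Real.rpow_add htan, hPz, neg_div (1 - 2*σ + 4*σ^2)]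
    ring
  exact key.comp hR
end

section
/- Suppose σ = 1/4 and P_z = 0. Then V(ρ) → ε (2/√(3Λ))^{4/3} + (L_z/c)² as ρ → (π/√(3Λ))⁻. -/
open Filter

/-- If `σ = 1/4` and `Pz = 0`, the effective potential `V(ρ)` tends to
`ε (2/√(3Λ))^{4/3} + (Lz/c)²` as `ρ` approaches the second singularity
`π/√(3Λ)` from below. -/
theorem LTV_tendsto_second_singularity_sigma_quarter (Λ σ b c Pz Lz ε : ℝ)
    (hΛ : 0 < Λ) (hb : b ≠ 0) (hc : c ≠ 0) (hε : ε = 0 ∨ ε = 1)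
    (hσ : σ = 1/4) (hPz : Pz = 0) :
    Tendsto (LTV Λ σ b c Pz Lz ε)
      (nhdsWithin (Real.pi / Real.sqrt (3*Λ)) (Set.Iio (Real.pi / Real.sqrt (3*Λ))))
      (nhds (ε * (2 / Real.sqrt (3*Λ)) ^ ((4:ℝ)/3) + (Lz / c)^2)) := by
  have hs : 0 < Real.sqrt (3*Λ) := Real.sqrt_pos.mpr (by linarith)
  subst hσ hPz
  unfold LTV
  generalize Real.sqrt (3*Λ) = s at hs
  have h0 : 0 < Real.pi / s := div_pos Real.pi_pos hs
  have e1 : (-(2 * (1 - 8*(1/4:ℝ) + 4*(1/4:ℝ)^2)) / (3 * (1 - 2*(1/4:ℝ) + 4*(1/4:ℝ)^2))) = 2/3 := by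
    norm_num
  have e2 : (-(2 * (1 - 4*(1/4:ℝ))) / (1 - 2*(1/4:ℝ) + 4*(1/4:ℝ)^2)) = 0 := by norm_num
  rw [e1, e2]
  have key : Tendsto (fun ρ : ℝ => ε * ((2 / s * Real.sin (s / 2 * ρ)) ^ 2) ^ ((2:ℝ)/3) + (Lz / c)^2)
      (nhdsWithin (Real.pi / s) (Set.Iio (Real.pi / s)))
      (nhds (ε * (2 / s) ^ ((4:ℝ)/3) + (Lz / c)^2)) := by
    have hc1 : Continuous (fun ρ : ℝ =>
        ε * ((2 / s * Real.sin (s / 2 * ρ)) ^ 2) ^ ((2:ℝ)/3) + (Lz / c)^2) := by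
      have h1 : Continuous (fun ρ : ℝ => (2 / s * Real.sin (s / 2 * ρ)) ^ 2) := by fun_prop
      exact (continuous_const.mul (h1.rpow_const (fun _ => Or.inr (by norm_num)))).add
        continuous_const
    have h2 := (hc1.tendsto (Real.pi / s)).mono_left
      (nhdsWithin_le_nhds (s := Set.Iio (Real.pi / s)))
    have h3 : s / 2 * (Real.pi / s) = Real.pi / 2 := by field_simp
    have h4 : ((2 / s) ^ 2) ^ ((2:ℝ)/3) = (2 / s) ^ ((4:ℝ)/3) := by
      rw [← Real.rpow_natCast, ← Real.rpow_mul (by positivity)]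
      norm_num
    simpa only [h3, Real.sin_pi_div_two, mul_one, h4] using h2
  refine key.congr' ?_
  have hpos : ∀ᶠ ρ in nhdsWithin (Real.pi / s) (Set.Iio (Real.pi / s)), 0 < ρ :=
    nhdsWithin_le_nhds (lt_mem_nhds h0)
  filter_upwards [hpos, self_mem_nhdsWithin] with ρ hρ hlt
  have hlt' : ρ * s < Real.pi := (lt_div_iff₀ hs).mp hlt
  have hR0 : 0 < s / 2 * ρ := by positivity
  have hR1 : s / 2 * ρ < Real.pi / 2 := by nlinarith
  have hsin : 0 < Real.sin (s / 2 * ρ) := Real.sin_pos_of_pos_of_lt_pi hR0 (by linarith)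
  have hcos : 0 < Real.cos (s / 2 * ρ) := Real.cos_pos_of_mem_Ioo ⟨by linarith, hR1⟩
  rw [Real.rpow_zero, Real.sin_two_mul, Real.tan_eq_sin_div_cos, mul_assoc ε,
    ← Real.mul_rpow (by positivity) (by positivity)]
  have e3 : 1 / s * (2 * Real.sin (s / 2 * ρ) * Real.cos (s / 2 * ρ)) *
      (2 / s * (Real.sin (s / 2 * ρ) / Real.cos (s / 2 * ρ)))
      = (2 / s * Real.sin (s / 2 * ρ)) ^ 2 := by
    generalize Real.sin (s / 2 * ρ) = x
    generalize Real.cos (s / 2 * ρ) = y at hcos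
    field_simp
  rw [e3]
  simp
end

section
/- Suppose σ = 0. Then V(ρ) → (P_z/b)² as ρ → (π/√(3Λ))⁻, for any ε ∈ {0,1} and any L_z. -/
open Filter

/-- If `σ = 0`, the effective potential `V(ρ)` tends to `(Pz/b)²` as `ρ`
approaches the second singularity `π/√(3Λ)` from below, for any `ε ∈ {0,1}`
and any `Lz`. -/
theorem LTV_tendsto_second_singularity_sigma_zero (Λ σ b c Pz Lz ε : ℝ)
    (hΛ : 0 < Λ) (hb : b ≠ 0) (hc : c ≠ 0) (hε : ε = 0 ∨ ε = 1) (hσ : σ = 0) :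
    Tendsto (LTV Λ σ b c Pz Lz ε)
      (nhdsWithin (Real.pi / Real.sqrt (3*Λ)) (Set.Iio (Real.pi / Real.sqrt (3*Λ))))
      (nhds ((Pz / b)^2)) := by
  subst hσ
  have hs : 0 < Real.sqrt (3*Λ) := Real.sqrt_pos.mpr (by linarith)
  unfold LTV
  set s := Real.sqrt (3*Λ) with hsdef
  have hlin : Tendsto (fun ρ : ℝ => s / 2 * ρ) (nhdsWithin (Real.pi / s) (Set.Iio (Real.pi / s)))
      (nhdsWithin (Real.pi / 2) (Set.Iio (Real.pi / 2))) := by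
    apply tendsto_nhdsWithin_of_tendsto_nhds_of_eventually_within
    · have h : Tendsto (fun ρ : ℝ => s / 2 * ρ) (nhds (Real.pi / s)) (nhds (s / 2 * (Real.pi / s))) :=
        (continuous_const.mul continuous_id).tendsto _
      have e : s / 2 * (Real.pi / s) = Real.pi / 2 := by field_simp
      rw [e] at h
      exact h.mono_left nhdsWithin_le_nhds
    · filter_upwards [self_mem_nhdsWithin] with ρ hρ
      have h1 : ρ < Real.pi / s := hρ
      rw [lt_div_iff₀ hs] at h1
      show s / 2 * ρ < Real.pi / 2
      linarith
  have hP : Tendsto (fun ρ : ℝ => 2 / s * Real.tan (s / 2 * ρ))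
      (nhdsWithin (Real.pi / s) (Set.Iio (Real.pi / s))) atTop :=
    (Real.tendsto_tan_pi_div_two.comp hlin).const_mul_atTop (by positivity)
  have hQ : Tendsto (fun ρ : ℝ => (1 / s * Real.sin (2 * (s / 2 * ρ))) ^ ((2:ℝ)/3))
      (nhdsWithin (Real.pi / s) (Set.Iio (Real.pi / s))) (nhds 0) := by
    have hcont : Continuous (fun x : ℝ => (1 / s * Real.sin (2 * x)) ^ ((2:ℝ)/3)) := by
      apply Continuous.rpow_const (by fun_prop)
      intro x
      right
      norm_num
    have h := (hcont.tendsto (Real.pi / 2)).comp (hlin.mono_right nhdsWithin_le_nhds)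
    have e : (1 / s * Real.sin (2 * (Real.pi / 2))) ^ ((2:ℝ)/3) = 0 := by
      rw [mul_div_cancel₀ _ (two_ne_zero), Real.sin_pi, mul_zero]
      exact Real.zero_rpow (by norm_num)
    rw [e] at h
    exact h
  have h1 := (tendsto_rpow_neg_atTop (show (0:ℝ) < 2/3 by norm_num)).comp hP
  have h2 := (tendsto_rpow_neg_atTop (show (0:ℝ) < 2 by norm_num)).comp hP
  have h := (((hQ.const_mul ε).mul h1).add_const ((Pz / b)^2)).add (h2.const_mul ((Lz / c)^2))
  have e1 : (-(2 * (1 - 8*(0:ℝ) + 4*0^2)) / (3 * (1 - 2*0 + 4*0^2))) = -(2/3) := by norm_num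
  have e2 : (8*(0:ℝ)*(1 - 0) / (1 - 2*0 + 4*0^2)) = 0 := by norm_num
  have e3 : (-(2 * (1 - 4*(0:ℝ))) / (1 - 2*0 + 4*0^2)) = -2 := by norm_num
  rw [e1, e2, e3]
  simpa [Function.comp_def] using h
end

section
/- Suppose 0 < σ < 1/4, L_z ≠ 0 and P_z ≠ 0 (ε ∈ {0,1} arbitrary). Then the continuous function V attains a global minimum at some ρ_e ∈ (0, π/√(3Λ)); moreover, for every E ∈ ℝ with E² > V(ρ_e) there exist ρ_min, ρ_max with 0 < ρ_min < ρ_e < ρ_max < π/√(3Λ) and V(ρ_min) = V(ρ_max) = E². Hence the corresponding non-planar geodesics are radially confined between two non-singular radii, never reaching either singularity ρ = 0 or ρ = π/√(3Λ). -/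
open Filter

theorem confine_aux {f : ℝ → ℝ} {a b : ℝ} (hab : a < b) (hf : ContinuousOn f (Set.Ioo a b))
    (ha : Tendsto f (nhdsWithin a (Set.Ioi a)) atTop)
    (hb : Tendsto f (nhdsWithin b (Set.Iio b)) atTop) :
    ∃ x ∈ Set.Ioo a b, (∀ y ∈ Set.Ioo a b, f x ≤ f y) ∧
      ∀ M : ℝ, f x < M → ∃ p q : ℝ, a < p ∧ p < x ∧ x < q ∧ q < b ∧ f p = M ∧ f q = M := by
  have hA : ∀ M : ℝ, ∃ u > a, ∀ y, a < y → y < u → M < f y := by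
    intro M
    have h := ha.eventually (eventually_gt_atTop M)
    obtain ⟨u, hu, h'⟩ := (mem_nhdsGT_iff_exists_Ioo_subset).1 h
    exact ⟨u, hu, fun y h1 h2 => h' ⟨h1, h2⟩⟩
  have hB : ∀ M : ℝ, ∃ u < b, ∀ y, u < y → y < b → M < f y := by
    intro M
    have h := hb.eventually (eventually_gt_atTop M)
    obtain ⟨u, hu, h'⟩ := (mem_nhdsLT_iff_exists_Ioo_subset).1 h
    exact ⟨u, hu, fun y h1 h2 => h' ⟨h1, h2⟩⟩
  obtain ⟨m, hm1, hm2⟩ := exists_between hab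
  obtain ⟨u, hu, hu'⟩ := hA (f m)
  obtain ⟨v, hv, hv'⟩ := hB (f m)
  have hmu : u ≤ m := by
    by_contra h
    exact lt_irrefl _ (hu' m hm1 (not_le.1 h))
  have hmv : m ≤ v := by
    by_contra h
    exact lt_irrefl _ (hv' m (not_le.1 h) hm2)
  have hsub : Set.Icc u v ⊆ Set.Ioo a b := fun y hy => ⟨hu.trans_le hy.1, hy.2.trans_lt hv⟩
  obtain ⟨x, hx, hmin⟩ := isCompact_Icc.exists_isMinOn ⟨m, hmu, hmv⟩ (hf.mono hsub)
  have hxI := hsub hx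
  have hxm : f x ≤ f m := hmin (show m ∈ Set.Icc u v from ⟨hmu, hmv⟩)
  refine ⟨x, hxI, ?_, ?_⟩
  · intro y hy
    rcases lt_or_ge y u with h | h
    · exact hxm.trans (hu' y hy.1 h).le
    rcases lt_or_ge v y with h2 | h2
    · exact hxm.trans (hv' y h2 hy.2).le
    exact hmin (show y ∈ Set.Icc u v from ⟨h, h2⟩)
  · intro M hM
    obtain ⟨u1, hu1, hu1'⟩ := hA M
    obtain ⟨v1, hv1, hv1'⟩ := hB M
    obtain ⟨p0, hp1, hp2⟩ := exists_between (lt_min hu1 hxI.1)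
    obtain ⟨q0, hq1, hq2⟩ := exists_between (max_lt hv1 hxI.2)
    have hp3 := lt_min_iff.1 hp2
    have hq3 := max_lt_iff.1 hq1
    have s1 : Set.Icc p0 x ⊆ Set.Ioo a b := fun y hy => ⟨hp1.trans_le hy.1, hy.2.trans_lt hxI.2⟩
    have s2 : Set.Icc x q0 ⊆ Set.Ioo a b := fun y hy => ⟨hxI.1.trans_le hy.1, hy.2.trans_lt hq2⟩
    obtain ⟨p, hp, hpM⟩ := intermediate_value_Ioo' hp3.2.le (hf.mono s1)
      ⟨hM, hu1' p0 hp1 hp3.1⟩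
    obtain ⟨q, hq, hqM⟩ := intermediate_value_Ioo hq3.2.le (hf.mono s2)
      ⟨hM, hv1' q0 hq3.1 hq2⟩
    exact ⟨p, q, hp1.trans hp.1, hp.2, hq.1, hq.2.trans hq2, hpM, hqM⟩

/-- For `0 < σ < 1/4`, `Lz ≠ 0` and `Pz ≠ 0`, the effective potential `V`
attains a global minimum at some `ρₑ ∈ (0, π/√(3Λ))`, and for every energy `E`
with `E² > V(ρₑ)` there are turning points `ρ_min, ρ_max` with
`0 < ρ_min < ρₑ < ρ_max < π/√(3Λ)` and `V(ρ_min) = V(ρ_max) = E²`: the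
corresponding non-planar geodesics are radially confined between two
non-singular radii, never reaching either singularity `ρ = 0` or
`ρ = π/√(3Λ)`. -/
theorem LTV_confinement (Λ σ b c Pz Lz ε : ℝ) (hΛ : 0 < Λ)
    (hb : b ≠ 0) (hc : c ≠ 0) (hε : ε = 0 ∨ ε = 1)
    (hσ0 : 0 < σ) (hσ : σ < 1/4) (hLz : Lz ≠ 0) (hPz : Pz ≠ 0) :
    ∃ ρe ∈ Set.Ioo (0:ℝ) (Real.pi / Real.sqrt (3*Λ)),
      (∀ ρ ∈ Set.Ioo (0:ℝ) (Real.pi / Real.sqrt (3*Λ)),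
        LTV Λ σ b c Pz Lz ε ρe ≤ LTV Λ σ b c Pz Lz ε ρ) ∧
      ∀ E : ℝ, LTV Λ σ b c Pz Lz ε ρe < E^2 →
        ∃ ρmin ρmax : ℝ,
          0 < ρmin ∧ ρmin < ρe ∧ ρe < ρmax ∧
          ρmax < Real.pi / Real.sqrt (3*Λ) ∧
          LTV Λ σ b c Pz Lz ε ρmin = E^2 ∧
          LTV Λ σ b c Pz Lz ε ρmax = E^2 := by
  have hk : 0 < Real.sqrt (3*Λ) := Real.sqrt_pos.2 (by linarith)
  have hS : 0 < 1 - 2*σ + 4*σ^2 := by nlinarith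
  have hε0 : 0 ≤ ε := by rcases hε with h | h <;> simp [h]
  have hA : 0 < (Pz / b)^2 := by positivity
  have hB : 0 < (Lz / c)^2 := by positivity
  have he2 : 0 < 8*σ*(1 - σ) / (1 - 2*σ + 4*σ^2) :=
    div_pos (mul_pos (by linarith) (by linarith)) hS
  have he3 : -(2 * (1 - 4*σ)) / (1 - 2*σ + 4*σ^2) < 0 :=
    div_neg_of_neg_of_pos (by linarith) hS
  unfold LTV
  generalize -(2 * (1 - 8*σ + 4*σ^2)) / (3 * (1 - 2*σ + 4*σ^2)) = e1
  generalize 8*σ*(1 - σ) / (1 - 2*σ + 4*σ^2) = e2 at *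
  generalize -(2 * (1 - 4*σ)) / (1 - 2*σ + 4*σ^2) = e3 at *
  generalize (Pz / b)^2 = A at *
  generalize (Lz / c)^2 = B at *
  generalize Real.sqrt (3*Λ) = k at *
  have hpi := Real.pi_pos
  have hR : ∀ ρ ∈ Set.Ioo (0:ℝ) (Real.pi / k), 0 < k/2*ρ ∧ k/2*ρ < Real.pi/2 := by
    intro ρ hρ
    have h1 := hρ.1
    have h2 := (lt_div_iff₀ hk).1 hρ.2
    exact ⟨by positivity, by linarith⟩
  have hP : ∀ ρ ∈ Set.Ioo (0:ℝ) (Real.pi / k), 0 < 2/k * Real.tan (k/2*ρ) := by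
    intro ρ hρ
    have := Real.tan_pos_of_pos_of_lt_pi_div_two (hR ρ hρ).1 (hR ρ hρ).2
    positivity
  have hQ : ∀ ρ ∈ Set.Ioo (0:ℝ) (Real.pi / k), 0 < 1/k * Real.sin (2*(k/2*ρ)) := by
    intro ρ hρ
    have := Real.sin_pos_of_pos_of_lt_pi (x := 2*(k/2*ρ))
      (by linarith [(hR ρ hρ).1]) (by linarith [(hR ρ hρ).2])
    positivity
  have hend : 0 < Real.pi / k := by positivity
  have hPc : ContinuousOn (fun ρ => 2/k * Real.tan (k/2*ρ)) (Set.Ioo (0:ℝ) (Real.pi / k)) := by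
    intro ρ hρ
    have hc0 : Real.cos (k/2*ρ) ≠ 0 :=
      (Real.cos_pos_of_mem_Ioo ⟨by linarith [(hR ρ hρ).1], (hR ρ hρ).2⟩).ne'
    have h1 : ContinuousAt (fun ρ : ℝ => Real.tan (k/2*ρ)) ρ :=
      ContinuousAt.comp (f := fun ρ : ℝ => k/2*ρ) (Real.continuousAt_tan.2 hc0) (by fun_prop)
    exact (continuousAt_const.mul h1).continuousWithinAt
  have hPr : ∀ e : ℝ, ContinuousOn (fun ρ => (2/k * Real.tan (k/2*ρ))^e)
      (Set.Ioo (0:ℝ) (Real.pi / k)) := fun e =>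
    hPc.rpow_const fun ρ hρ => Or.inl (hP ρ hρ).ne'
  have hQr : ContinuousOn (fun ρ => (1/k * Real.sin (2*(k/2*ρ)))^((2:ℝ)/3))
      (Set.Ioo (0:ℝ) (Real.pi / k)) :=
    ContinuousOn.rpow_const (by fun_prop) fun ρ hρ => Or.inl (hQ ρ hρ).ne'
  have hcont := (((continuousOn_const (c := ε)).mul hQr).mul (hPr e1)).add
    ((continuousOn_const (c := A)).mul (hPr e2)) |>.add ((continuousOn_const (c := B)).mul (hPr e3))
  have hl : ∀ᶠ ρ in nhdsWithin (0:ℝ) (Set.Ioi 0), ρ ∈ Set.Ioo (0:ℝ) (Real.pi / k) :=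
    Ioo_mem_nhdsGT hend
  have hr : ∀ᶠ ρ in nhdsWithin (Real.pi / k) (Set.Iio (Real.pi / k)),
      ρ ∈ Set.Ioo (0:ℝ) (Real.pi / k) := Ioo_mem_nhdsLT hend
  have hP0 : Tendsto (fun ρ => 2/k * Real.tan (k/2*ρ)) (nhdsWithin (0:ℝ) (Set.Ioi 0))
      (nhdsWithin 0 (Set.Ioi 0)) := by
    refine tendsto_nhdsWithin_iff.2 ⟨?_, hl.mono hP⟩
    have h1 : ContinuousAt (fun ρ : ℝ => Real.tan (k/2*ρ)) 0 :=
      ContinuousAt.comp (f := fun ρ : ℝ => k/2*ρ)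
        (Real.continuousAt_tan.2 (by simp)) (by fun_prop)
    have h2 : Tendsto (fun ρ => 2/k * Real.tan (k/2*ρ)) (nhds 0)
        (nhds (2/k * Real.tan (k/2*0))) := h1.tendsto.const_mul (2/k)
    rw [mul_zero, Real.tan_zero, mul_zero] at h2
    exact h2.mono_left nhdsWithin_le_nhds
  have hP1 : Tendsto (fun ρ => 2/k * Real.tan (k/2*ρ))
      (nhdsWithin (Real.pi / k) (Set.Iio (Real.pi / k))) atTop := by
    refine Tendsto.const_mul_atTop (by positivity) (Real.tendsto_tan_pi_div_two.comp ?_)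
    refine tendsto_nhdsWithin_iff.2 ⟨?_, hr.mono fun ρ hρ => (hR ρ hρ).2⟩
    have h2 : ContinuousAt (fun ρ : ℝ => k/2*ρ) (Real.pi/k) := by fun_prop
    have h3 := h2.tendsto
    have h4 : k/2*(Real.pi/k) = Real.pi/2 := by field_simp
    rw [h4] at h3
    exact h3.mono_left nhdsWithin_le_nhds
  have T0 := ((tendsto_rpow_neg_nhdsGT_zero he3).comp hP0).const_mul_atTop hB
  have T1 := ((tendsto_rpow_atTop he2).comp hP1).const_mul_atTop hA
  obtain ⟨x, hx, hmin, hM⟩ := confine_aux hend hcont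
    (tendsto_atTop_mono' _ (hl.mono fun ρ hρ => by
      have p1 := hP ρ hρ
      have q1 := hQ ρ hρ
      have t1 := mul_nonneg (mul_nonneg hε0 (Real.rpow_nonneg q1.le ((2:ℝ)/3)))
        (Real.rpow_nonneg p1.le e1)
      have t2 := mul_nonneg hA.le (Real.rpow_nonneg p1.le e2)
      exact le_add_of_nonneg_left (add_nonneg t1 t2)) T0)
    (tendsto_atTop_mono' _ (hr.mono fun ρ hρ => by
      have p1 := hP ρ hρ
      have q1 := hQ ρ hρ
      have t1 := mul_nonneg (mul_nonneg hε0 (Real.rpow_nonneg q1.le ((2:ℝ)/3)))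
        (Real.rpow_nonneg p1.le e1)
      have t3 := mul_nonneg hB.le (Real.rpow_nonneg p1.le e3)
      exact (le_add_of_nonneg_left t1).trans (le_add_of_nonneg_right t3)) T1)
  exact ⟨x, hx, hmin, fun E hE => hM (E^2) hE⟩
end
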